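/- Fix a constant ε > 0. Let G be a graph on n vertices which is a strong (α,δ)-expander with α = (1+ε)·log₂ n and δ = 1/α, and let Z be the number of pure Nash equilibria of a random game on G. Then there exists a constant C (depending only on ε) such that for all sufficiently large n, the total variation distance between the law of Z and a Poisson(1) random variable W satisfies ||Z − W|| ≤ C·(n^{−ε} + 2^{−n/2}). -/

import Mathlib

open scoped Classical
open Finset

/-- Best-response tables of a graphical game with binary strategies on vertex set `V`:
player `v`'s table assigns a best response `ω v τ ∈ {0,1}` to each (masked) strategy
profile `τ`. Only the values at profiles vanishing outside the neighborhood of `v` are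
ever read, so under the uniform measure the read entries are i.i.d. uniform on `{0,1}`. -/
abbrev Tables (V : Type) := V → (V → Bool) → Bool

/-- Restriction of a strategy profile to the neighborhood of `v` in `G`
(strategies outside the neighborhood are replaced by `false`). -/
noncomputable def maskN {V : Type} (G : SimpleGraph V) (v : V) (σ : V → Bool) : V → Bool :=
  fun u => if G.Adj v u then σ u else false

/-- `σ` is a pure Nash equilibrium of the game on `G` with tables `ω`:
every player plays a best response to the strategies of its neighbors. -/
def isPNE {V : Type} (G : SimpleGraph V) (ω : Tables V) (σ : V → Bool) : Prop :=
  ∀ v, σ v = ω v (maskN G v σ)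

/-- Probability of a table event under the uniform measure on best-response tables
(the random game on a fixed graph). -/
noncomputable def probT (V : Type) [Fintype V] [DecidableEq V] (A : Tables V → Prop) : ℝ :=
  (∑ ω : Tables V, if A ω then (1 : ℝ) else 0) / (Fintype.card (Tables V) : ℝ)

/-- The degree of a vertex `v` in `G`. -/
noncomputable def degOf {V : Type} [Fintype V] (G : SimpleGraph V) (v : V) : ℕ :=
  (univ.filter fun u => G.Adj v u).card

/-- `G` is a strong `(α,δ)`-expander: every vertex set `S` with `|S| ≤ δ|V|` has at least
`α|S|` neighbors, and every `S` with `|S| > δ|V|` has all of `V` as neighbors, where the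
neighborhood is `N(S) = {w : ∃ u ∈ S, (w,u) ∈ E}` (which may intersect `S`). -/
def StrongExpander {V : Type} [Fintype V] [DecidableEq V] (G : SimpleGraph V)
    (α δ : ℝ) : Prop :=
  ∀ S : Finset V,
    ((S.card : ℝ) ≤ δ * Fintype.card V →
      α * S.card ≤ ((univ.filter fun w => ∃ u ∈ S, G.Adj w u).card : ℝ)) ∧
    (δ * (Fintype.card V : ℝ) < S.card →
      (univ.filter fun w => ∃ u ∈ S, G.Adj w u) = univ)


section Helpers

/-- Solution of the Stein equation for the Poisson(1) law. -/
theorem stein_solution (h : ℕ → ℝ) (hh : ∀ k, |h k| ≤ 1) :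
    ∃ f : ℕ → ℝ, (∀ j, |f j| ≤ 4) ∧
      ∀ j : ℕ, f (j + 1) - j * f j =
        h j - ∑' k : ℕ, h k * (Real.exp (-1) / (Nat.factorial k : ℝ)) := by
  set m : ℝ := ∑' k : ℕ, h k * (Real.exp (-1) / (Nat.factorial k : ℝ)) with hm
  have hsE : HasSum (fun k : ℕ => 1 / (Nat.factorial k : ℝ)) (Real.exp 1) := by
    have := NormedSpace.expSeries_div_hasSum_exp (1 : ℝ)
    rw [← Real.exp_eq_exp_ℝ] at this
    simpa using this
  have hexp : Real.exp (-1) * Real.exp 1 = 1 := by rw [← Real.exp_add]; simp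
  have hsW : HasSum (fun k : ℕ => Real.exp (-1) / (Nat.factorial k : ℝ)) 1 := by
    have := hsE.mul_left (Real.exp (-1))
    rw [hexp] at this
    simpa [div_eq_mul_inv] using this
  have hnn : ∀ k : ℕ, 0 ≤ Real.exp (-1) / (Nat.factorial k : ℝ) := fun k => by positivity
  have hbd : ∀ k : ℕ, ‖h k * (Real.exp (-1) / (Nat.factorial k : ℝ))‖
      ≤ Real.exp (-1) / (Nat.factorial k : ℝ) := by
    intro k
    rw [norm_mul, Real.norm_eq_abs, Real.norm_eq_abs, abs_of_nonneg (hnn k)]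
    have := mul_le_mul_of_nonneg_right (hh k) (hnn k)
    simpa using this
  have hsh : Summable (fun k : ℕ => h k * (Real.exp (-1) / (Nat.factorial k : ℝ))) :=
    Summable.of_norm_bounded hsW.summable hbd
  have hm1 : |m| ≤ 1 := by
    have := tsum_of_norm_bounded hsW hbd
    simpa [hm] using this
  have hg2 : ∀ k, |h k - m| ≤ 2 := by
    intro k
    have := abs_sub (h k) m
    have := hh k
    linarith [abs_sub (h k) m]
  have hsg : HasSum (fun k : ℕ => (h k - m) / (Nat.factorial k : ℝ)) 0 := by
    have h1 : HasSum (fun k : ℕ => h k * (Real.exp (-1) / (Nat.factorial k : ℝ))) m := hsh.hasSum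
    have h2 := (h1.sub (hsW.mul_left m)).mul_left (Real.exp 1)
    simp only [mul_one, sub_self, mul_zero] at h2
    refine h2.congr_fun fun k => ?_
    have : (Nat.factorial k : ℝ) ≠ 0 := by positivity
    field_simp
    linear_combination (-(h k - m)) * hexp
  refine ⟨fun j => match j with
    | 0 => 0
    | (j + 1) => (Nat.factorial j : ℝ) *
        ∑ i ∈ range (j + 1), (h i - m) / (Nat.factorial i : ℝ), ?_, ?_⟩
  · intro j
    cases j with
    | zero => simp
    | succ j =>
      simp only
      have hs := hsg.summable.sum_add_tsum_nat_add (j + 1)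
      rw [hsg.tsum_eq] at hs
      have heq : ∑ i ∈ range (j + 1), (h i - m) / (Nat.factorial i : ℝ)
          = - ∑' i : ℕ, (h (i + (j + 1)) - m) / (Nat.factorial (i + (j + 1)) : ℝ) := by
        linarith
      rw [heq, mul_neg, abs_neg, ← tsum_mul_left]
      have hs1 : HasSum (fun i : ℕ => 2 * (1 / (Nat.factorial (i + 1) : ℝ)))
          (2 * (Real.exp 1 - 1)) := by
        refine HasSum.mul_left _ ?_
        have := (hasSum_nat_add_iff' 1).mpr hsE
        simpa using this
      have hb := tsum_of_norm_bounded hs1 (f := fun i : ℕ => (Nat.factorial j : ℝ) *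
        ((h (i + (j + 1)) - m) / (Nat.factorial (i + (j + 1)) : ℝ))) (by
          intro i
          have hd : (Nat.factorial j : ℝ) * (Nat.factorial (i + 1) : ℝ)
              ≤ (Nat.factorial (i + (j + 1)) : ℝ) := by
            have h0 := Nat.le_of_dvd (Nat.factorial_pos _)
              (Nat.factorial_mul_factorial_dvd_factorial_add j (i + 1))
            have e : j + (i + 1) = i + (j + 1) := by ring
            rw [e] at h0
            exact_mod_cast h0
          rw [norm_mul, norm_div, Real.norm_eq_abs, Real.norm_eq_abs, Real.norm_eq_abs,
            Nat.abs_cast, Nat.abs_cast]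
          have p1 : (0 : ℝ) < Nat.factorial (i + 1) := by positivity
          have p2 : (0 : ℝ) < Nat.factorial (i + (j + 1)) := by positivity
          have p3 : (0 : ℝ) < Nat.factorial j := by positivity
          rw [← mul_div_assoc, ← mul_div_assoc, div_le_div_iff₀ p2 p1]
          have := hg2 (i + (j + 1))
          calc (Nat.factorial j : ℝ) * |h (i + (j + 1)) - m| * (Nat.factorial (i + 1) : ℝ)
              = |h (i + (j + 1)) - m| * ((Nat.factorial j : ℝ) * (Nat.factorial (i + 1) : ℝ)) := by
                ring
            _ ≤ 2 * (Nat.factorial (i + (j + 1)) : ℝ) := by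
                apply mul_le_mul this hd <;> positivity
            _ = _ := by ring)
      rw [Real.norm_eq_abs] at hb
      have := Real.exp_one_lt_d9
      linarith
  · intro j
    cases j with
    | zero => simp
    | succ j =>
      simp only
      rw [Finset.sum_range_succ _ (j + 1), Nat.factorial_succ]
      have : (Nat.factorial j : ℝ) ≠ 0 := by positivity
      push_cast
      have : (j : ℝ) + 1 ≠ 0 := by positivity
      field_simp
      ring

variable {V : Type} [Fintype V] [DecidableEq V]

/-- Flip one table entry. -/
def flipT (v : V) (t : V → Bool) (ω : Tables V) : Tables V :=
  fun w s => if w = v ∧ s = t then !(ω w s) else ω w s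

theorem flipT_flipT (v : V) (t : V → Bool) (ω : Tables V) :
    flipT v t (flipT v t ω) = ω := by
  funext w s
  unfold flipT
  split_ifs <;> simp

theorem half_sum (v : V) (t : V → Bool) (c : Bool) (F : Tables V → ℝ)
    (hF : ∀ ω, F (flipT v t ω) = F ω) :
    ∑ ω : Tables V, (if c = ω v t then F ω else 0) = (1 / 2) * ∑ ω : Tables V, F ω := by
  have h1 : ∑ ω : Tables V, (if c = ω v t then F ω else 0)
      = ∑ ω : Tables V, (if c = ω v t then 0 else F ω) := by
    refine Finset.sum_bij' (fun ω _ => flipT v t ω) (fun ω _ => flipT v t ω) ?_ ?_ ?_ ?_ ?_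
    · simp
    · simp
    · intro ω _; exact flipT_flipT v t ω
    · intro ω _; exact flipT_flipT v t ω
    · intro ω _
      rw [hF]
      have : flipT v t ω v t = !(ω v t) := by simp [flipT]
      rw [this]
      cases c <;> cases ω v t <;> simp
  have h2 : ∑ ω : Tables V, (if c = ω v t then F ω else 0)
      + ∑ ω : Tables V, (if c = ω v t then 0 else F ω) = ∑ ω : Tables V, F ω := by
    rw [← Finset.sum_add_distrib]
    refine Finset.sum_congr rfl fun ω _ => ?_
    split_ifs <;> simp
  linarith

theorem indep_sum (G : SimpleGraph V) (σ : V → Bool) (F : Tables V → ℝ) (T : Finset V) :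
    (∀ v ∈ T, ∀ ω, F (flipT v (maskN G v σ) ω) = F ω) →
    ∑ ω : Tables V, (if ∀ v ∈ T, σ v = ω v (maskN G v σ) then F ω else 0)
      = (1 / 2) ^ T.card * ∑ ω : Tables V, F ω := by
  induction T using Finset.induction_on with
  | empty => intro _; simp
  | insert v T hv ih =>
    intro hF
    have e : ∀ ω : Tables V,
        (if ∀ u ∈ insert v T, σ u = ω u (maskN G u σ) then F ω else 0)
        = if σ v = ω v (maskN G v σ) then
            (if ∀ u ∈ T, σ u = ω u (maskN G u σ) then F ω else 0) else 0 := by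
      intro ω
      rw [← ite_and]
      simp only [Finset.forall_mem_insert]
    simp_rw [e]
    rw [half_sum v (maskN G v σ) (σ v)
      (fun ω => if ∀ u ∈ T, σ u = ω u (maskN G u σ) then F ω else 0),
      ih (fun u hu => hF u (Finset.mem_insert_of_mem hu)), Finset.card_insert_of_notMem hv]
    · ring
    · intro ω
      rw [hF v (Finset.mem_insert_self _ _)]
      have : (∀ u ∈ T, σ u = flipT v (maskN G v σ) ω u (maskN G u σ))
          ↔ (∀ u ∈ T, σ u = ω u (maskN G u σ)) := by
        refine forall₂_congr fun u hu => ?_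
        have hne : u ≠ v := fun h => hv (h ▸ hu)
        simp [flipT, hne]
      simp only [this]

/-- Players whose neighborhoods see a difference between two profiles. -/
noncomputable def diffD (G : SimpleGraph V) (σ τ : V → Bool) : Finset V :=
  univ.filter fun v => maskN G v σ ≠ maskN G v τ

/-- Indicator of being an equilibrium. -/
noncomputable def XX (G : SimpleGraph V) (σ : V → Bool) (ω : Tables V) : ℝ :=
  if isPNE G ω σ then 1 else 0

/-- Number of equilibria. -/
noncomputable def ZZ (G : SimpleGraph V) (ω : Tables V) : ℕ :=
  (univ.filter fun σ : V → Bool => isPNE G ω σ).card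

/-- Number of equilibria outside the dependency neighborhood. -/
noncomputable def VV (G : SimpleGraph V) (σ : V → Bool) (ω : Tables V) : ℕ :=
  (univ.filter fun τ : V → Bool => isPNE G ω τ ∧ diffD G σ τ = univ).card

theorem XX_nonneg (G : SimpleGraph V) (σ : V → Bool) (ω : Tables V) : 0 ≤ XX G σ ω := by
  unfold XX; split_ifs <;> norm_num

theorem isPNE_flip (G : SimpleGraph V) (τ : V → Bool) (v : V) (t : V → Bool) (ω : Tables V)
    (h : maskN G v τ ≠ t) : isPNE G (flipT v t ω) τ ↔ isPNE G ω τ := by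
  unfold isPNE
  refine forall_congr' fun u => ?_
  have : ¬ (u = v ∧ maskN G u τ = t) := by
    rintro ⟨rfl, h'⟩; exact h h'
  simp [flipT, this]

theorem sum_X_mul (G : SimpleGraph V) (σ : V → Bool) (F : Tables V → ℝ)
    (hF : ∀ v, ∀ ω, F (flipT v (maskN G v σ) ω) = F ω) :
    ∑ ω : Tables V, XX G σ ω * F ω = (1 / 2) ^ (Fintype.card V) * ∑ ω : Tables V, F ω := by
  have := indep_sum G σ F univ (fun v _ => hF v)
  rw [Finset.card_univ] at this
  rw [← this]
  refine Finset.sum_congr rfl fun ω _ => ?_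
  unfold XX
  by_cases hc : isPNE G ω σ
  · rw [if_pos hc, if_pos (fun v _ => hc v), one_mul]
  · rw [if_neg hc, if_neg (fun h => hc fun v => h v (Finset.mem_univ v)), zero_mul]

theorem sum_X (G : SimpleGraph V) (σ : V → Bool) :
    ∑ ω : Tables V, XX G σ ω = (1 / 2) ^ (Fintype.card V) * (Fintype.card (Tables V) : ℝ) := by
  have := sum_X_mul G σ (fun _ => 1) (fun _ _ => rfl)
  simpa using this

theorem sum_XV (G : SimpleGraph V) (σ : V → Bool) (f : ℕ → ℝ) :
    ∑ ω : Tables V, XX G σ ω * f (VV G σ ω + 1)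
      = (1 / 2) ^ (Fintype.card V) * ∑ ω : Tables V, f (VV G σ ω + 1) := by
  refine sum_X_mul G σ (fun ω => f (VV G σ ω + 1)) fun v ω => ?_
  have : VV G σ (flipT v (maskN G v σ) ω) = VV G σ ω := by
    unfold VV
    congr 1
    refine Finset.filter_congr fun τ _ => ?_
    refine and_congr_left fun hD => ?_
    have hv : v ∈ diffD G σ τ := by rw [hD]; exact Finset.mem_univ v
    apply isPNE_flip
    simp only [diffD, Finset.mem_filter] at hv
    exact fun h => hv.2 h.symm
  simp only [this]

theorem sum_XX (G : SimpleGraph V) (σ τ : V → Bool) :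
    ∑ ω : Tables V, XX G σ ω * XX G τ ω
      ≤ (1 / 2) ^ (diffD G σ τ).card * ((1 / 2) ^ (Fintype.card V) *
        (Fintype.card (Tables V) : ℝ)) := by
  rw [← sum_X G τ, ← indep_sum G σ (XX G τ) (diffD G σ τ)]
  · refine Finset.sum_le_sum fun ω _ => ?_
    by_cases hp : isPNE G ω σ
    · have : ∀ v ∈ diffD G σ τ, σ v = ω v (maskN G v σ) := fun v _ => hp v
      rw [if_pos this]
      simp [XX, hp]
    · have h0 : XX G σ ω = 0 := by simp [XX, hp]
      rw [h0, zero_mul]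
      split_ifs
      · exact XX_nonneg _ _ _
      · exact le_rfl
  · intro v hv ω
    simp only [diffD, Finset.mem_filter] at hv
    unfold XX
    rw [isPNE_flip G τ v _ ω (fun h => hv.2 h.symm)]

/-- The dependency neighborhood. -/
noncomputable def BB (G : SimpleGraph V) (σ : V → Bool) : Finset (V → Bool) :=
  univ.filter fun τ => diffD G σ τ ≠ univ

theorem stepA (G : SimpleGraph V) (σ : V → Bool) (ω : Tables V) (f : ℕ → ℝ)
    (hf : ∀ j, |f j| ≤ 4) :
    |f (ZZ G ω + 1) - f (VV G σ ω + 1)| ≤ 8 * ∑ τ ∈ BB G σ, XX G τ ω := by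
  by_cases h : ∃ τ ∈ BB G σ, isPNE G ω τ
  · obtain ⟨τ, hτ, hp⟩ := h
    have h1 : XX G τ ω ≤ ∑ τ ∈ BB G σ, XX G τ ω :=
      Finset.single_le_sum (f := fun τ => XX G τ ω) (fun τ _ => XX_nonneg G τ ω) hτ
    have h2 : XX G τ ω = 1 := by simp [XX, hp]
    have := abs_sub (f (ZZ G ω + 1)) (f (VV G σ ω + 1))
    linarith [hf (ZZ G ω + 1), hf (VV G σ ω + 1)]
  · push Not at h
    have : ZZ G ω = VV G σ ω := by
      unfold ZZ VV
      congr 1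
      refine Finset.filter_congr fun τ _ => ?_
      refine ⟨fun hp => ⟨hp, ?_⟩, fun hp => hp.1⟩
      by_contra hD
      exact h τ (by simp [BB, hD]) hp
    rw [this, sub_self, abs_zero]
    have := Finset.sum_nonneg (s := BB G σ) (fun τ _ => XX_nonneg G τ ω)
    linarith

theorem stepB [Nonempty V] (G : SimpleGraph V) (σ : V → Bool) (ω : Tables V) (f : ℕ → ℝ)
    (hf : ∀ j, |f j| ≤ 4) :
    |XX G σ ω * (f (VV G σ ω + 1) - f (ZZ G ω))|
      ≤ 8 * ∑ τ ∈ (BB G σ).erase σ, XX G σ ω * XX G τ ω := by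
  have hnn := Finset.sum_nonneg (s := (BB G σ).erase σ)
    (f := fun τ => XX G σ ω * XX G τ ω)
    (fun τ _ => mul_nonneg (XX_nonneg G σ ω) (XX_nonneg G τ ω))
  by_cases hσ : isPNE G ω σ
  swap
  · have : XX G σ ω = 0 := by simp [XX, hσ]
    simp [this]
  have hX : XX G σ ω = 1 := by simp [XX, hσ]
  simp only [hX, one_mul] at hnn ⊢
  by_cases h : ∃ τ ∈ (BB G σ).erase σ, isPNE G ω τ
  · obtain ⟨τ, hτ, hp⟩ := h
    have h1 : XX G τ ω ≤ ∑ τ ∈ (BB G σ).erase σ, XX G τ ω :=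
      Finset.single_le_sum (f := fun τ => XX G τ ω) (fun τ _ => XX_nonneg G τ ω) hτ
    have h2 : XX G τ ω = 1 := by simp [XX, hp]
    have := abs_sub (f (VV G σ ω + 1)) (f (ZZ G ω))
    linarith [hf (ZZ G ω), hf (VV G σ ω + 1)]
  · push Not at h
    have : ZZ G ω = VV G σ ω + 1 := by
      unfold ZZ VV
      rw [← Finset.card_insert_of_notMem (a := σ)]
      · congr 1
        ext τ
        simp only [Finset.mem_filter, Finset.mem_insert, Finset.mem_univ, true_and]
        constructor
        · intro hp
          by_cases hτ : τ = σ
          · exact Or.inl hτ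
          · refine Or.inr ⟨hp, ?_⟩
            by_contra hD
            exact h τ (by simp [BB, hD, hτ]) hp
        · rintro (rfl | hp)
          · exact hσ
          · exact hp.1
      · simp only [Finset.mem_filter, not_and]
        intro _ _ hD
        have : (Classical.arbitrary V) ∈ diffD G σ σ := by rw [hD]; exact Finset.mem_univ _
        simp [diffD] at this
    rw [this, sub_self, abs_zero]
    linarith

/-- The Chen–Stein bound. -/
theorem chen_stein [Nonempty V] (G : SimpleGraph V) (q : ℝ) (f : ℕ → ℝ)
    (hf : ∀ j, |f j| ≤ 4)
    (hq : ∀ σ, ∑ τ ∈ (BB G σ).erase σ, (1 / 2 : ℝ) ^ (diffD G σ τ).card ≤ q) :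
    |∑ ω : Tables V, (f (ZZ G ω + 1) - ZZ G ω * f (ZZ G ω))|
      ≤ 8 * ((1 / 2) ^ (Fintype.card V) + 2 * q) * (Fintype.card (Tables V) : ℝ) := by
  set p : ℝ := (1 / 2) ^ (Fintype.card V) with hp
  set K : ℝ := (Fintype.card (Tables V) : ℝ) with hK
  have hp0 : 0 < p := by positivity
  have hK0 : 0 ≤ K := by positivity
  have hcard : (Fintype.card (V → Bool) : ℝ) * p = 1 := by
    rw [hp, Fintype.card_fun, Fintype.card_bool]
    push_cast
    rw [← mul_pow]; norm_num
  have hZ : ∀ ω, (ZZ G ω : ℝ) = ∑ σ : V → Bool, XX G σ ω := by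
    intro ω
    simp [ZZ, XX]
  have hdec : ∑ ω : Tables V, (f (ZZ G ω + 1) - ZZ G ω * f (ZZ G ω))
      = ∑ σ : V → Bool, ∑ ω : Tables V,
        (p * (f (ZZ G ω + 1) - f (VV G σ ω + 1))
          + XX G σ ω * (f (VV G σ ω + 1) - f (ZZ G ω))) := by
    have h0 : ∀ σ : V → Bool, ∑ ω : Tables V,
        (p * (f (ZZ G ω + 1) - f (VV G σ ω + 1))
          + XX G σ ω * (f (VV G σ ω + 1) - f (ZZ G ω)))
        = ∑ ω : Tables V, (p * f (ZZ G ω + 1) - XX G σ ω * f (ZZ G ω)) := by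
      intro σ
      have h1 := sum_XV G σ f
      rw [← hp, Finset.mul_sum] at h1
      have h2 : ∑ ω : Tables V, (XX G σ ω * f (VV G σ ω + 1) - p * f (VV G σ ω + 1)) = 0 := by
        rw [Finset.sum_sub_distrib, h1, sub_self]
      rw [← add_zero (∑ ω : Tables V, (p * f (ZZ G ω + 1) - XX G σ ω * f (ZZ G ω))), ← h2,
        ← Finset.sum_add_distrib]
      refine Finset.sum_congr rfl fun ω _ => ?_
      ring
    simp_rw [h0]
    rw [Finset.sum_comm]
    refine Finset.sum_congr rfl fun ω _ => ?_
    rw [Finset.sum_sub_distrib, ← Finset.sum_mul, ← Finset.sum_mul, ← hZ, Finset.sum_const,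
      Finset.card_univ, nsmul_eq_mul, hcard, one_mul]
  rw [hdec]
  have hσ : ∀ σ : V → Bool, |∑ ω : Tables V,
        (p * (f (ZZ G ω + 1) - f (VV G σ ω + 1))
          + XX G σ ω * (f (VV G σ ω + 1) - f (ZZ G ω)))| ≤ p * (8 * (p + 2 * q) * K) := by
    intro σ
    calc _ ≤ ∑ ω : Tables V, |p * (f (ZZ G ω + 1) - f (VV G σ ω + 1))
          + XX G σ ω * (f (VV G σ ω + 1) - f (ZZ G ω))| := Finset.abs_sum_le_sum_abs _ _
      _ ≤ ∑ ω : Tables V, (p * (8 * ∑ τ ∈ BB G σ, XX G τ ω)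
            + 8 * ∑ τ ∈ (BB G σ).erase σ, XX G σ ω * XX G τ ω) := by
          refine Finset.sum_le_sum fun ω _ => ?_
          refine (abs_add_le _ _).trans (add_le_add ?_ (stepB G σ ω f hf))
          rw [abs_mul, abs_of_pos hp0]
          exact mul_le_mul_of_nonneg_left (stepA G σ ω f hf) hp0.le
      _ = p * (8 * ∑ τ ∈ BB G σ, ∑ ω : Tables V, XX G τ ω)
            + 8 * ∑ τ ∈ (BB G σ).erase σ, ∑ ω : Tables V, XX G σ ω * XX G τ ω := by
          rw [Finset.sum_add_distrib, ← Finset.mul_sum, ← Finset.mul_sum, ← Finset.mul_sum,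
            Finset.sum_comm, Finset.sum_comm (t := (BB G σ).erase σ)]
      _ ≤ p * (8 * ((p + q) * K)) + 8 * (q * (p * K)) := by
          refine add_le_add ?_ ?_
          · refine mul_le_mul_of_nonneg_left ?_ hp0.le
            refine mul_le_mul_of_nonneg_left ?_ (by norm_num)
            simp_rw [sum_X]
            rw [← hp, ← hK, ← Finset.sum_mul]
            refine mul_le_mul_of_nonneg_right ?_ hK0
            have h1 : ∑ τ ∈ BB G σ, p ≤ ∑ τ ∈ insert σ ((BB G σ).erase σ), p := by
              refine Finset.sum_le_sum_of_subset_of_nonneg ?_ (fun _ _ _ => hp0.le)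
              exact Finset.insert_erase_subset σ _
            rw [Finset.sum_insert (Finset.notMem_erase _ _)] at h1
            have h2 : ∑ τ ∈ (BB G σ).erase σ, p
                ≤ ∑ τ ∈ (BB G σ).erase σ, (1 / 2 : ℝ) ^ (diffD G σ τ).card := by
              refine Finset.sum_le_sum fun τ _ => ?_
              exact pow_le_pow_of_le_one (by norm_num) (by norm_num) (Finset.card_le_univ _)
            linarith [hq σ]
          · refine mul_le_mul_of_nonneg_left ?_ (by norm_num)
            calc _ ≤ ∑ τ ∈ (BB G σ).erase σ, (1 / 2 : ℝ) ^ (diffD G σ τ).card * (p * K) :=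
                  Finset.sum_le_sum fun τ _ => sum_XX G σ τ
              _ ≤ q * (p * K) := by
                  rw [← Finset.sum_mul]
                  exact mul_le_mul_of_nonneg_right (hq σ) (by positivity)
      _ = _ := by ring
  calc _ ≤ ∑ σ : V → Bool, |∑ ω : Tables V,
        (p * (f (ZZ G ω + 1) - f (VV G σ ω + 1))
          + XX G σ ω * (f (VV G σ ω + 1) - f (ZZ G ω)))| := Finset.abs_sum_le_sum_abs _ _
    _ ≤ ∑ σ : V → Bool, p * (8 * (p + 2 * q) * K) := Finset.sum_le_sum fun σ _ => hσ σ
    _ = _ := by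
        rw [Finset.sum_const, Finset.card_univ, nsmul_eq_mul, ← mul_assoc, hcard, one_mul]

theorem tv_bound [Nonempty V] (G : SimpleGraph V) (q : ℝ)
    (hq : ∀ σ, ∑ τ ∈ (BB G σ).erase σ, (1 / 2 : ℝ) ^ (diffD G σ τ).card ≤ q) :
    ∑' k : ℕ, |probT V (fun ω => ZZ G ω = k) - Real.exp (-1) / (Nat.factorial k : ℝ)|
      ≤ 8 * ((1 / 2) ^ (Fintype.card V) + 2 * q) := by
  set w : ℕ → ℝ := fun k => Real.exp (-1) / (Nat.factorial k : ℝ) with hw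
  set P : ℕ → ℝ := fun k => probT V (fun ω => ZZ G ω = k) with hP
  set h : ℕ → ℝ := fun k => if 0 ≤ P k - w k then 1 else -1 with hh
  have hh1 : ∀ k, |h k| ≤ 1 := by
    intro k; simp only [hh]; split_ifs <;> simp
  have habs : ∀ k, |P k - w k| = h k * P k - h k * w k := by
    intro k
    simp only [hh]
    split_ifs with hk
    · rw [abs_of_nonneg hk]; ring
    · rw [abs_of_neg (not_le.mp hk)]; ring
  obtain ⟨f, hf, hst⟩ := stein_solution h hh1
  have hK : (0 : ℝ) < (Fintype.card (Tables V) : ℝ) := by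
    exact_mod_cast Fintype.card_pos
  have hsP : HasSum (fun k => h k * P k)
      ((∑ ω : Tables V, h (ZZ G ω)) / (Fintype.card (Tables V) : ℝ)) := by
    have h1 : HasSum (fun k => ∑ ω : Tables V, if k = ZZ G ω then h (ZZ G ω) else 0)
        (∑ ω : Tables V, h (ZZ G ω)) :=
      hasSum_sum fun ω _ => hasSum_ite_eq (ZZ G ω) (h (ZZ G ω))
    have h2 := h1.div_const (Fintype.card (Tables V) : ℝ)
    refine h2.congr_fun fun k => ?_
    simp only [hP, probT]
    rw [← mul_div_assoc, Finset.mul_sum]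
    congr 1
    refine Finset.sum_congr rfl fun ω _ => ?_
    by_cases hk : ZZ G ω = k
    · simp [hk]
    · simp [hk, Ne.symm hk]
  have hsw : Summable (fun k => h k * w k) := by
    have hs0 : Summable w := by
      have := (Real.summable_pow_div_factorial 1).mul_left (Real.exp (-1))
      simpa [hw, div_eq_mul_inv] using this
    refine Summable.of_norm_bounded hs0 fun k => ?_
    have hwk : 0 ≤ w k := by simp only [hw]; positivity
    rw [norm_mul, Real.norm_eq_abs, Real.norm_eq_abs, abs_of_nonneg hwk]
    have := mul_le_mul_of_nonneg_right (hh1 k) hwk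
    simpa using this
  have hcs := chen_stein G q f hf hq
  have e1 : ∑' k : ℕ, |P k - w k|
      = (∑ ω : Tables V, (f (ZZ G ω + 1) - ZZ G ω * f (ZZ G ω)))
        / (Fintype.card (Tables V) : ℝ) := by
    simp only [habs, hst]
    rw [hsP.summable.tsum_sub hsw, hsP.tsum_eq, Finset.sum_sub_distrib, Finset.sum_const,
      Finset.card_univ, nsmul_eq_mul, sub_div, mul_div_cancel_left₀ _ hK.ne']
  rw [e1, div_le_iff₀ hK]
  exact (le_abs_self _).trans hcs

theorem sum_hamming (σ : V → Bool) (x : ℝ) :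
    ∑ τ : V → Bool, x ^ (univ.filter fun u => σ u ≠ τ u).card
      = (1 + x) ^ (Fintype.card V) := by
  have h1 : ∀ τ : V → Bool, x ^ (univ.filter fun u => σ u ≠ τ u).card
      = ∏ u, (if σ u ≠ τ u then x else 1) := by
    intro τ
    rw [Finset.prod_ite]
    simp
  simp_rw [h1]
  have h2 := Finset.prod_univ_sum (fun _ : V => (univ : Finset Bool))
    (fun u b => if σ u ≠ b then x else (1 : ℝ))
  rw [Fintype.piFinset_univ] at h2
  rw [← h2]
  have h3 : ∀ u, ∑ b : Bool, (if σ u ≠ b then x else (1 : ℝ)) = 1 + x := by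
    intro u
    rw [Fintype.sum_bool]
    cases σ u <;> simp [add_comm]
  simp_rw [h3]
  simp

theorem diffD_eq (G : SimpleGraph V) (σ τ : V → Bool) :
    diffD G σ τ = univ.filter fun w => ∃ u ∈ (univ.filter fun u => σ u ≠ τ u), G.Adj w u := by
  ext w
  simp only [diffD, Finset.mem_filter, Finset.mem_univ, true_and]
  rw [Function.ne_iff]
  refine exists_congr fun u => ?_
  unfold maskN
  by_cases h : G.Adj w u <;> simp [h]

theorem q_bound (G : SimpleGraph V) (α δ : ℝ) (hG : StrongExpander G α δ) (σ : V → Bool) :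
    ∑ τ ∈ (BB G σ).erase σ, (1 / 2 : ℝ) ^ (diffD G σ τ).card
      ≤ (1 + (2 : ℝ) ^ (-α)) ^ (Fintype.card V) - 1 := by
  set x : ℝ := (2 : ℝ) ^ (-α) with hx
  have hx0 : 0 < x := by positivity
  calc _ ≤ ∑ τ ∈ (BB G σ).erase σ, x ^ (univ.filter fun u => σ u ≠ τ u).card := by
        refine Finset.sum_le_sum fun τ hτ => ?_
        have hD : diffD G σ τ ≠ univ := by
          have := Finset.mem_of_mem_erase hτ
          simpa [BB] using this
        set S := univ.filter fun u => σ u ≠ τ u with hS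
        have hDS : diffD G σ τ = univ.filter fun w => ∃ u ∈ S, G.Adj w u := by
          rw [diffD_eq]; ext w; simp [hS]
        have hsmall : (S.card : ℝ) ≤ δ * Fintype.card V := by
          by_contra hc
          exact hD (hDS.trans ((hG S).2 (not_le.mp hc)))
        have hexp := (hG S).1 hsmall
        rw [← hDS] at hexp
        have e1 : (1 / 2 : ℝ) ^ (diffD G σ τ).card = (2 : ℝ) ^ (-((diffD G σ τ).card : ℝ)) := by
          rw [Real.rpow_neg (by norm_num), Real.rpow_natCast]
          simp
        have e2 : x ^ S.card = (2 : ℝ) ^ (-(α * S.card)) := by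
          rw [hx, ← Real.rpow_natCast, ← Real.rpow_mul (by norm_num)]
          congr 1; ring
        rw [e1, e2]
        exact Real.rpow_le_rpow_of_exponent_le (by norm_num) (by linarith)
    _ ≤ ∑ τ ∈ univ.erase σ, x ^ (univ.filter fun u => σ u ≠ τ u).card := by
        refine Finset.sum_le_sum_of_subset_of_nonneg ?_ (fun _ _ _ => by positivity)
        exact Finset.erase_subset_erase _ (Finset.subset_univ _)
    _ = _ := by
        have h1 := Finset.add_sum_erase univ
          (fun τ : V → Bool => x ^ (univ.filter fun u => σ u ≠ τ u).card) (Finset.mem_univ σ)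
        rw [sum_hamming] at h1
        simp only [ne_eq, not_true_eq_false, Finset.filter_false, Finset.card_empty,
          pow_zero] at h1
        linarith

end Helpers

/-- **Expander graphs.** If `G` on `n` vertices is a strong `(α,δ)`-expander with
`α = (1+ε) log₂ n` and `δ = 1/α`, then the total variation distance between the law of
the number of PNE of a random game on `G` and Poisson(1) is at most
`C (n^{-ε} + 2^{-n/2})`, for all sufficiently large `n`. -/
theorem stmt6 (ε : ℝ) (hε : 0 < ε) :
    ∃ C : ℝ, 0 < C ∧ ∃ N : ℕ, ∀ n : ℕ, N ≤ n → ∀ G : SimpleGraph (Fin n),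
      StrongExpander G ((1 + ε) * Real.logb 2 n) (((1 + ε) * Real.logb 2 n))⁻¹ →
      (1 / 2) * ∑' k : ℕ,
          |probT (Fin n)
              (fun ω => (univ.filter fun σ : Fin n → Bool => isPNE G ω σ).card = k) -
            Real.exp (-1) / (Nat.factorial k : ℝ)|
        ≤ C * ((n : ℝ) ^ (-ε) + (2 : ℝ) ^ (-(n : ℝ) / 2)) := by
  refine ⟨16, by norm_num, 2, fun n hn G hG => ?_⟩
  have : Nonempty (Fin n) := ⟨⟨0, by omega⟩⟩
  have hn0 : (0 : ℝ) < n := by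
    have : 0 < n := by omega
    exact_mod_cast this
  have hn1 : (1 : ℝ) ≤ n := by
    have : 1 ≤ n := by omega
    exact_mod_cast this
  have hq := q_bound G _ _ hG
  have hx : (2 : ℝ) ^ (-((1 + ε) * Real.logb 2 n)) = (n : ℝ) ^ (-(1 + ε)) := by
    have e : -((1 + ε) * Real.logb 2 n) = Real.logb 2 n * (-(1 + ε)) := by ring
    rw [e, Real.rpow_mul (by norm_num), Real.rpow_logb (by norm_num) (by norm_num) hn0]
  rw [hx, Fintype.card_fin] at hq
  have hnx : (n : ℝ) * (n : ℝ) ^ (-(1 + ε)) = (n : ℝ) ^ (-ε) := by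
    have e : -ε = 1 + (-(1 + ε)) := by ring
    rw [e, Real.rpow_add hn0, Real.rpow_one]
  have hpos : 0 < (n : ℝ) ^ (-ε) := by positivity
  have hle1 : (n : ℝ) ^ (-ε) ≤ 1 :=
    Real.rpow_le_one_of_one_le_of_nonpos hn1 (by linarith)
  have hpow : (1 + (n : ℝ) ^ (-(1 + ε))) ^ n - 1 ≤ 2 * (n : ℝ) ^ (-ε) := by
    have h1 : (1 + (n : ℝ) ^ (-(1 + ε))) ^ n ≤ Real.exp ((n : ℝ) ^ (-ε)) := by
      rw [← hnx, Real.exp_nat_mul]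
      refine pow_le_pow_left₀ (by positivity) ?_ n
      linarith [Real.add_one_le_exp ((n : ℝ) ^ (-(1 + ε)))]
    have h2 := Real.abs_exp_sub_one_le (x := (n : ℝ) ^ (-ε)) (by rwa [abs_of_pos hpos])
    rw [abs_of_pos hpos] at h2
    linarith [le_abs_self (Real.exp ((n : ℝ) ^ (-ε)) - 1)]
  have htv := tv_bound G _ (fun σ => (hq σ).trans hpow)
  rw [Fintype.card_fin] at htv
  have hhalf : (1 / 2 : ℝ) ^ n ≤ (2 : ℝ) ^ (-(n : ℝ) / 2) := by
    have e1 : (1 / 2 : ℝ) ^ n = (2 : ℝ) ^ (-(n : ℝ)) := by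
      rw [Real.rpow_neg (by norm_num), Real.rpow_natCast]
      simp
    rw [e1]
    exact Real.rpow_le_rpow_of_exponent_le (by norm_num) (by linarith)
  have hp2 : 0 < (2 : ℝ) ^ (-(n : ℝ) / 2) := by positivity
  unfold ZZ at htv
  linarith
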